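/- Let p be a prime number, let K be a field of characteristic p that is algebraic over its prime field 𝔽_p, and let K' be any field of characteristic p. If the Golomb spaces G(K[X]) and G(K'[X]) are homeomorphic, then K and K' are isomorphic as fields. -/

import Mathlib

open Polynomial Filter

noncomputable section

/-- The Golomb space of a domain: the nonzero elements. -/
abbrev GolombSpace (R : Type*) [CommRing R] := {x : R // x ≠ 0}

/-- The Golomb topology: generated by coprime cosets `x + I`. -/
instance golombTopology (R : Type*) [CommRing R] : TopologicalSpace (GolombSpace R) :=
  TopologicalSpace.generateFrom
    {S : Set (GolombSpace R) | ∃ (x : R) (I : Ideal R), x ≠ 0 ∧ I ≠ ⊥ ∧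
      Ideal.span {x} ⊔ I = ⊤ ∧ S = {y : GolombSpace R | ∃ i ∈ I, (y : R) = x + i}}

/-- `G_n(R)`: nonzero elements contained in exactly `n` maximal ideals. -/
def golombGn (R : Type*) [CommRing R] (n : ℕ) : Set (GolombSpace R) :=
  {x | ∃ Δ : Finset (Ideal R), Δ.card = n ∧ (∀ P ∈ Δ, P.IsMaximal) ∧
    (∀ P : Ideal R, P.IsMaximal → ((x : R) ∈ P ↔ P ∈ Δ))}

/-- The `P`-topology on `R ∖ P`, generated by the cosets `a + Pⁿ`, `n ≥ 1`. -/
instance padicCosetTopology {R : Type*} [CommRing R] (P : Ideal R) :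
    TopologicalSpace {x : R // x ∉ P} :=
  TopologicalSpace.generateFrom
    {S : Set {x : R // x ∉ P} | ∃ (a : R) (n : ℕ), a ∉ P ∧ 1 ≤ n ∧
      S = {y : {x : R // x ∉ P} | ∃ b ∈ P ^ n, (y : R) = a + b}}

/-- Convergence of a sequence to `l` in the `P`-topology on `R ∖ P`. -/
def PTendsto {R : Type*} [CommRing R] (P : Ideal R) (s : ℕ → R) (l : R) : Prop :=
  ∃ (hl : l ∉ P) (hs : ∀ n, s n ∉ P),
    Filter.Tendsto (fun n => (⟨s n, hs n⟩ : {x : R // x ∉ P})) Filter.atTop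
      (nhds (⟨l, hl⟩ : {x : R // x ∉ P}))

/-- `⟨a⟩ = { u·aⁿ : u a unit, n ≥ 1 }`, as a subset of the Golomb space. -/
def golombPow {R : Type*} [CommRing R] (a : R) : Set (GolombSpace R) :=
  {y | ∃ (u : R) (n : ℕ), IsUnit u ∧ 1 ≤ n ∧ (y : R) = u * a ^ n}


/-! ### General topology -/

def gTT {X : Type*} [TopologicalSpace X] (x z y : X) : Prop :=
  ∀ W : Set X, IsOpen W → y ∈ W → ∃ U V : Set X, IsOpen U ∧ x ∈ U ∧ IsOpen V ∧ z ∈ V ∧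
    closure U ∩ closure V ⊆ closure W

lemma gTT_map {X Y : Type*} [TopologicalSpace X] [TopologicalSpace Y] (e : X ≃ₜ Y) {x z y : X}
    (h : gTT x z y) : gTT (e x) (e z) (e y) := by
  intro W hW hy
  obtain ⟨U, V, hU, hx, hV, hz, hs⟩ := h (e ⁻¹' W) (hW.preimage e.continuous) hy
  refine ⟨e.symm ⁻¹' U, e.symm ⁻¹' V, hU.preimage e.symm.continuous, by simpa using hx,
    hV.preimage e.symm.continuous, by simpa using hz, ?_⟩
  rw [← e.symm.preimage_closure, ← e.symm.preimage_closure]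
  rintro w ⟨h1, h2⟩
  have := hs ⟨h1, h2⟩
  rw [← e.preimage_closure] at this
  simpa using this

def gRC {X : Type*} [TopologicalSpace X] (A U : Set X) : Prop :=
  (∃ O, IsOpen O ∧ O ∩ A = U) ∧ ∃ F, IsClosed F ∧ F ∩ A = U

lemma gRC_preimage {X Y : Type*} [TopologicalSpace X] [TopologicalSpace Y] (e : X ≃ₜ Y)
    {A U : Set Y} (h : gRC A U) : gRC (e ⁻¹' A) (e ⁻¹' U) := by
  obtain ⟨⟨O, hO, h1⟩, F, hF, h2⟩ := h
  exact ⟨⟨e ⁻¹' O, hO.preimage e.continuous, by rw [← h1]; rfl⟩,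
    e ⁻¹' F, hF.preimage e.continuous, by rw [← h2]; rfl⟩

def gRel {X : Type*} [TopologicalSpace X] (A B Q : Set X) (u v : X) : Prop :=
  ∀ U V : Set X, gRC A U → u ∈ U → gRC B V → v ∈ V → ∃ y ∈ Q, y ∈ U ∧ y ∈ V

lemma gRel_map {X Y : Type*} [TopologicalSpace X] [TopologicalSpace Y] (e : X ≃ₜ Y)
    {A B Q : Set Y} {u v : X} (h : gRel (e ⁻¹' A) (e ⁻¹' B) (e ⁻¹' Q) u v) :
    gRel A B Q (e u) (e v) := by
  intro U V hU hu hV hv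
  obtain ⟨y, hy, h1, h2⟩ := h _ _ (gRC_preimage e hU) hu (gRC_preimage e hV) hv
  exact ⟨e y, hy, h1, h2⟩

/-! ### Basic facts on the Golomb topology of `K[X]` -/

section basics

variable {K : Type*} [Field K]

def gcoset (c a : K[X]) : Set (GolombSpace K[X]) := {y | c ∣ y.1 - a}

lemma gcoset_isOpen {c a : K[X]} (hc : c ≠ 0) (ha : a ≠ 0) (h : IsCoprime c a) :
    IsOpen (gcoset c a) := by
  apply TopologicalSpace.isOpen_generateFrom_of_mem
  refine ⟨a, Ideal.span {c}, ha, by simpa using hc, ?_, ?_⟩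
  · rw [← Ideal.isCoprime_iff_sup_eq, Ideal.isCoprime_span_singleton_iff]
    exact h.symm
  · ext y
    simp only [gcoset, Set.mem_ofPred_eq, Ideal.mem_span_singleton]
    constructor
    · intro h; exact ⟨_, h, by ring⟩
    · rintro ⟨i, hi, h⟩; rw [h]; simpa using hi

lemma gopen_nhds {O : Set (GolombSpace K[X])} (hO : IsOpen O) {w : GolombSpace K[X]}
    (hw : w ∈ O) : ∃ c : K[X], c ≠ 0 ∧ IsCoprime c w.1 ∧ gcoset c w.1 ⊆ O := by
  induction hO with
  | basic s hs =>
    obtain ⟨x, I, hx, hI, hco, rfl⟩ := hs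
    obtain ⟨c, rfl⟩ := IsPrincipalIdealRing.principal I
    rw [← Ideal.isCoprime_iff_sup_eq, Ideal.submodule_span_eq,
      Ideal.isCoprime_span_singleton_iff] at hco
    obtain ⟨i, hi, hwi⟩ := hw
    rw [Ideal.submodule_span_eq, Ideal.mem_span_singleton] at hi
    refine ⟨c, by rintro rfl; simp at hI, ?_, ?_⟩
    · obtain ⟨t, rfl⟩ := hi
      rw [hwi]
      exact IsCoprime.add_mul_left_right hco.symm t
    · intro y hy
      refine ⟨y.1 - x, ?_, by ring⟩
      rw [Ideal.submodule_span_eq, Ideal.mem_span_singleton]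
      have : y.1 - x = (y.1 - w.1) + i := by rw [hwi]; ring
      rw [this]
      exact dvd_add hy hi
  | univ => exact ⟨1, one_ne_zero, isCoprime_one_left, fun _ _ => trivial⟩
  | inter s t _ _ ihs iht =>
    obtain ⟨c, hc, h1, h2⟩ := ihs hw.1
    obtain ⟨d, hd, h3, h4⟩ := iht hw.2
    exact ⟨c * d, mul_ne_zero hc hd, h1.mul_left h3, fun y hy =>
      ⟨h2 ((dvd_mul_right c d).trans hy), h4 ((dvd_mul_left d c).trans hy)⟩⟩
  | sUnion S _ ih =>
    obtain ⟨s, hs, hws⟩ := hw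
    obtain ⟨c, hc, h1, h2⟩ := ih s hs hws
    exact ⟨c, hc, h1, fun y hy => ⟨s, hs, h2 hy⟩⟩

lemma gmem_self (c : K[X]) (w : GolombSpace K[X]) : w ∈ gcoset c w.1 := by simp [gcoset]

lemma gmem_closure' {c a : K[X]} (hc : c ≠ 0) (ha : IsCoprime c a) {w : GolombSpace K[X]} :
    w ∈ closure (gcoset c a) ↔ ∀ d, d ∣ c → IsCoprime d w.1 → d ∣ w.1 - a := by
  constructor
  · intro h d hd hdw
    have hd0 : d ≠ 0 := by rintro rfl; exact hc (zero_dvd_iff.1 hd)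
    rw [mem_closure_iff] at h
    obtain ⟨y, h1, h2⟩ := h _ (gcoset_isOpen hd0 w.2 hdw) (gmem_self d w)
    have : w.1 - a = (y.1 - a) - (y.1 - w.1) := by ring
    rw [this]
    exact dvd_sub (hd.trans h2) h1
  · intro h
    rw [mem_closure_iff]
    intro O hO hw
    obtain ⟨d, hd, hdw, hsub⟩ := gopen_nhds hO hw
    classical
    have key := h (EuclideanDomain.gcd c d) (EuclideanDomain.gcd_dvd_left _ _)
      (IsCoprime.of_isCoprime_of_dvd_left hdw (EuclideanDomain.gcd_dvd_right _ _))
    obtain ⟨t, ht⟩ := key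
    have hb := EuclideanDomain.gcd_eq_gcd_ab c d
    set y : K[X] := a + c * (EuclideanDomain.gcdA c d * t) with hy
    have hyw : y - w.1 = - (d * (EuclideanDomain.gcdB c d * t)) := by
      have : w.1 = a + EuclideanDomain.gcd c d * t := by rw [← ht]; ring
      rw [this, hb, hy]; ring
    by_cases hy0 : y = 0
    · have hcu : IsUnit c := by
        apply ha.isUnit_of_dvd' dvd_rfl
        have : a = - (c * (EuclideanDomain.gcdA c d * t)) := by
          rw [hy0] at hy; linear_combination -hy
        rw [this]; exact (dvd_mul_right _ _).neg_right
      exact ⟨w, hw, hcu.dvd⟩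
    · refine ⟨⟨y, hy0⟩, hsub ?_, ?_⟩
      · show d ∣ y - w.1
        rw [hyw]; exact (dvd_mul_right _ _).neg_right
      · show c ∣ y - a
        rw [hy, add_sub_cancel_left]; exact dvd_mul_right _ _

lemma gcrt {m n : K[X]} (h : IsCoprime m n) (a : K[X]) : ∃ w, m ∣ w - a ∧ n ∣ w := by
  obtain ⟨u, v, huv⟩ := h
  exact ⟨a * v * n, ⟨-a * u, by linear_combination a * huv⟩, ⟨a * v, by ring⟩⟩

lemma gsplit {π c : K[X]} (hπ : Irreducible π) (hc : c ≠ 0) :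
    ∃ (j : ℕ) (d : K[X]), c = π ^ j * d ∧ ¬ π ∣ d :=
  ⟨_, (FiniteMultiplicity.of_not_isUnit hπ.not_isUnit hc).exists_eq_pow_mul_and_not_dvd⟩

lemma gcop {π w : K[X]} (hπ : Irreducible π) (hw : ¬ π ∣ w) (k : ℕ) : IsCoprime (π ^ k) w :=
  (hπ.coprime_iff_not_dvd.2 hw).pow_left

lemma gnot_dvd_of_cop {π c w : K[X]} (hπ : Irreducible π) (h : IsCoprime c w) (hw : π ∣ w) :
    ¬ π ∣ c := fun hc => hπ.not_isUnit (h.isUnit_of_dvd' hc hw)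

/-- divisors of `π ^ j * d` coprime to a multiple of `d` divide `π ^ j`. -/
lemma gdiv {P d e w : K[X]} (he : e ∣ P * d) (hw : d ∣ w) (hco : IsCoprime e w) :
    e ∣ P :=
  (hco.of_isCoprime_of_dvd_right hw).dvd_of_dvd_mul_right he

lemma gbound {a : K[X]} (ha : a ≠ 0) : ∃ k : ℕ, 1 ≤ k ∧ ∀ d, d ^ k ∣ a → IsUnit d := by
  refine ⟨a.natDegree + 1, by omega, fun d hd => ?_⟩
  have hd0 : d ≠ 0 := by
    rintro rfl
    simp at hd
    exact ha hd
  have h := natDegree_le_of_dvd hd ha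
  rw [natDegree_pow] at h
  have : d.natDegree = 0 := by
    by_contra h0
    have : 1 ≤ d.natDegree := Nat.pos_of_ne_zero h0
    nlinarith
  rw [isUnit_iff_degree_eq_zero, degree_eq_natDegree hd0, this]; rfl

def gS (x y : K[X]) : Prop := ∀ π, Irreducible π → π ∣ x → π ∣ y

lemma gTT_of {x z y : GolombSpace K[X]} (hxz : x ≠ z) (h1 : gS x.1 y.1) (h2 : gS z.1 y.1) :
    gTT x z y := by
  intro W hW hy
  obtain ⟨c, hc, hcy, hsub⟩ := gopen_nhds hW hy
  have cop : ∀ x : K[X], gS x y.1 → IsCoprime c x := by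
    intro x hx
    classical
    rw [← EuclideanDomain.gcd_isUnit_iff]
    by_contra hu
    obtain ⟨π, hπ, hd⟩ := WfDvdMonoid.exists_irreducible_factor hu
      (fun h0 => hc (EuclideanDomain.gcd_eq_zero_iff.1 h0).1)
    exact gnot_dvd_of_cop hπ hcy (hx π hπ (hd.trans (EuclideanDomain.gcd_dvd_right _ _)))
      (hd.trans (EuclideanDomain.gcd_dvd_left _ _))
  have hne : x.1 - z.1 ≠ 0 := fun h => hxz (Subtype.ext (sub_eq_zero.1 h))
  obtain ⟨k, hk, hbd⟩ := gbound hne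
  have hck : c ^ k ≠ 0 := pow_ne_zero _ hc
  have cx : IsCoprime (c ^ k) x.1 := (cop _ h1).pow_left
  have cz : IsCoprime (c ^ k) z.1 := (cop _ h2).pow_left
  refine ⟨gcoset (c ^ k) x.1, gcoset (c ^ k) z.1, gcoset_isOpen hck x.2 cx, gmem_self _ _,
    gcoset_isOpen hck z.2 cz, gmem_self _ _, ?_⟩
  rintro w ⟨hw1, hw2⟩
  apply closure_mono hsub
  rw [gmem_closure' hck cx] at hw1
  rw [gmem_closure' hck cz] at hw2
  rw [gmem_closure' hc hcy]
  intro d hd hdw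
  have a1 := hw1 (d ^ k) (pow_dvd_pow_of_dvd hd k) hdw.pow_left
  have a2 := hw2 (d ^ k) (pow_dvd_pow_of_dvd hd k) hdw.pow_left
  refine (hbd d ?_).dvd
  have : x.1 - z.1 = (w.1 - z.1) - (w.1 - x.1) := by ring
  rw [this]; exact dvd_sub a2 a1

lemma gTT_symm {X : Type*} [TopologicalSpace X] {x z y : X} (h : gTT x z y) : gTT z x y := by
  intro W hW hy
  obtain ⟨U, V, a, b, c, d, e⟩ := h W hW hy
  exact ⟨V, U, c, d, a, b, by rwa [Set.inter_comm]⟩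

lemma gS_of_TT {x z y : GolombSpace K[X]} (hyz : y ≠ z)
    (h : gTT x z y) : gS x.1 y.1 := by
  intro π hπ hx
  by_contra hy
  obtain ⟨z0, k, hz0, hk, hkd, hzz⟩ : ∃ (z0 : K[X]) (k : ℕ), ¬ π ∣ z0 ∧ 1 ≤ k ∧
      ¬ π ^ k ∣ z0 - y.1 ∧ (¬ π ∣ z.1 → z0 = z.1) := by
    by_cases hz : π ∣ z.1
    · refine ⟨y.1 + π, 2, ?_, by norm_num, ?_, fun h => absurd hz h⟩
      · rwa [dvd_add_self_right]
      · rw [add_sub_cancel_left, pow_two]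
        intro h
        have : π * π ∣ π * 1 := by simpa using h
        exact hπ.not_isUnit (isUnit_of_dvd_one ((mul_dvd_mul_iff_left hπ.ne_zero).1 this))
    · have hne : z.1 - y.1 ≠ 0 := fun h => hyz (Subtype.ext (sub_eq_zero.1 h).symm)
      obtain ⟨k, hk, hb⟩ := gbound hne
      exact ⟨z.1, k, hz, hk, fun h => hπ.not_isUnit (hb π h), fun _ => rfl⟩
  have hπk : π ^ k ≠ 0 := pow_ne_zero _ hπ.ne_zero
  obtain ⟨U, V, hU, hxU, hV, hzV, hs⟩ := h _ (gcoset_isOpen hπk y.2 (gcop hπ hy k)) (gmem_self _ _)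
  obtain ⟨c, hc, hcx, hcU⟩ := gopen_nhds hU hxU
  obtain ⟨d, hd, hdz, hdV⟩ := gopen_nhds hV hzV
  obtain ⟨j, d', rfl, hd'⟩ := gsplit hπ hd
  have hcπ : ¬ π ∣ c := gnot_dvd_of_cop hπ hcx hx
  have hcd : ¬ π ∣ c * d' := fun h => (hπ.prime.dvd_or_dvd h).elim hcπ hd'
  obtain ⟨w, hw1, hw2⟩ := gcrt (gcop hπ hcd (j + k)) z0
  have hπw : ¬ π ∣ w := by
    intro h
    apply hz0
    have h3 : π ∣ w - z0 := (dvd_pow_self π (by omega)).trans hw1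
    exact (dvd_sub_right h).1 h3
  have hw0 : w ≠ 0 := by rintro rfl; simp at hπw
  have hmem := hs (show (⟨w, hw0⟩ : GolombSpace K[X]) ∈ _ from ⟨closure_mono hcU ?_, closure_mono hdV ?_⟩)
  · rw [gmem_closure' hπk (gcop hπ hy k)] at hmem
    have h4 := hmem _ dvd_rfl (gcop hπ hπw k)
    apply hkd
    have h5 : π ^ k ∣ w - z0 := (pow_dvd_pow π (by omega)).trans hw1
    have : z0 - y.1 = (w - y.1) - (w - z0) := by ring
    rw [this]; exact dvd_sub h4 h5
  · rw [gmem_closure' hc hcx]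
    intro e he hew
    exact (hew.isUnit_of_dvd' dvd_rfl (he.trans ((dvd_mul_right _ _).trans hw2))).dvd
  · rw [gmem_closure' hd hdz]
    intro e he hew
    have h6 : e ∣ π ^ j := gdiv he ((dvd_mul_left _ _).trans hw2) hew
    by_cases hz : π ∣ z.1
    · have : j = 0 := by
        by_contra hj
        exact gnot_dvd_of_cop hπ hdz hz ((dvd_pow_self π hj).trans (dvd_mul_right _ _))
      subst this
      exact (isUnit_of_dvd_one (by simpa using h6)).dvd
    · rw [← hzz hz]
      exact h6.trans ((pow_dvd_pow π (by omega)).trans hw1)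

/-- clopen sets of `R ∖ P` contain `P`-adic neighbourhoods -/
lemma gRC_nhds {π : K[X]} (hπ : Irreducible π) {A U : Set (GolombSpace K[X])}
    (hA : ∀ y, y ∈ A ↔ ¬ π ∣ y.1) (hU : gRC A U) {u : GolombSpace K[X]} (hu : u ∈ U) :
    ∃ k : ℕ, 1 ≤ k ∧ ∀ y : GolombSpace K[X], π ^ k ∣ y.1 - u.1 → y ∈ U := by
  obtain ⟨⟨O, hO, hOU⟩, F, hF, hFU⟩ := hU
  have huA : ¬ π ∣ u.1 := by rw [← hA]; rw [← hOU] at hu; exact hu.2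
  have huO : u ∈ O := by rw [← hOU] at hu; exact hu.1
  obtain ⟨c, hc, hcu, hcO⟩ := gopen_nhds hO huO
  obtain ⟨k, d, hkd, hd⟩ := gsplit hπ (mul_ne_zero hπ.ne_zero hc)
  have hc' : π * c ≠ 0 := mul_ne_zero hπ.ne_zero hc
  have hcu' : IsCoprime (π * c) u.1 := IsCoprime.mul_left (hπ.coprime_iff_not_dvd.2 huA) hcu
  have hk : 1 ≤ k := by
    rcases Nat.eq_zero_or_pos k with rfl | h
    · exact absurd ⟨c, by simpa using hkd.symm⟩ hd
    · exact h
  have tr : ∀ {y a : K[X]} {m : ℕ}, 1 ≤ m → π ^ m ∣ y - a → ¬ π ∣ a → ¬ π ∣ y := by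
    intro y a m hm h ha hy
    have h3 : π ∣ y - a := (dvd_pow_self π (by omega)).trans h
    exact ha ((dvd_sub_right hy).1 h3)
  have sub1 : closure (gcoset (π * c) u.1) ⊆ F := by
    apply closure_minimal _ hF
    intro y hy
    have hyc : π * c ∣ y.1 - u.1 := hy
    have : y ∈ U := by
      rw [← hOU]
      refine ⟨hcO ((dvd_mul_left _ _).trans hyc), (hA y).2 ?_⟩
      exact tr le_rfl (by simpa using (dvd_mul_right _ _).trans hyc) huA
    rw [← hFU] at this; exact this.1
  refine ⟨k, hk, fun a ha => ?_⟩
  have haA : ¬ π ∣ a.1 := tr hk ha huA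
  rw [← hFU]
  refine ⟨?_, (hA a).2 haA⟩
  rw [← hF.closure_eq, mem_closure_iff]
  intro N hN haN
  obtain ⟨e, he, hea, heN⟩ := gopen_nhds hN haN
  have he' : π * e ≠ 0 := mul_ne_zero hπ.ne_zero he
  have hea' : IsCoprime (π * e) a.1 := IsCoprime.mul_left (hπ.coprime_iff_not_dvd.2 haA) hea
  obtain ⟨j, f, hjf, hf⟩ := gsplit hπ he'
  have hdf : ¬ π ∣ d * f := fun h => (hπ.prime.dvd_or_dvd h).elim hd hf
  obtain ⟨b, hb1, hb2⟩ := gcrt (gcop hπ hdf (j + k)) a.1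
  have hbA : ¬ π ∣ b := tr (by omega) hb1 haA
  have hb0 : b ≠ 0 := by rintro rfl; simp at hbA
  have hbU : (⟨b, hb0⟩ : GolombSpace K[X]) ∈ U := by
    rw [← hFU]
    refine ⟨sub1 ?_, (hA _).2 hbA⟩
    rw [gmem_closure' hc' hcu']
    intro g hg hgb
    rw [hkd] at hg
    have h6 : g ∣ π ^ k := gdiv hg ((dvd_mul_right _ _).trans hb2) hgb
    refine h6.trans ?_
    have : b - u.1 = (b - a.1) + (a.1 - u.1) := by ring
    show π ^ k ∣ b - u.1
    rw [this]
    exact dvd_add ((pow_dvd_pow π (by omega)).trans hb1) ha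
  have hbcl : (⟨b, hb0⟩ : GolombSpace K[X]) ∈ closure (gcoset (π * e) a.1) := by
    rw [gmem_closure' he' hea']
    intro g hg hgb
    rw [hjf] at hg
    have h6 : g ∣ π ^ j := gdiv hg ((dvd_mul_left _ _).trans hb2) hgb
    exact h6.trans ((pow_dvd_pow π (by omega)).trans hb1)
  rw [mem_closure_iff] at hbcl
  have hbO : (⟨b, hb0⟩ : GolombSpace K[X]) ∈ O := by rw [← hOU] at hbU; exact hbU.1
  obtain ⟨y, hyO, hy⟩ := hbcl O hO hbO
  have hyc : π * e ∣ y.1 - a.1 := hy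
  have hyU : y ∈ U := by
    rw [← hOU]
    exact ⟨hyO, (hA y).2 (tr le_rfl (by simpa using (dvd_mul_right _ _).trans hyc) haA)⟩
  refine ⟨y, heN ((dvd_mul_left _ _).trans hyc), ?_⟩
  rw [← hFU] at hyU; exact hyU.1

lemma gRC_coset {π : K[X]} (hπ : Irreducible π) {A : Set (GolombSpace K[X])}
    (hA : ∀ y, y ∈ A ↔ ¬ π ∣ y.1) {u : GolombSpace K[X]} (hu : ¬ π ∣ u.1) {k : ℕ} (hk : 1 ≤ k) :
    gRC A (gcoset (π ^ k) u.1) := by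
  have hπk : π ^ k ≠ 0 := pow_ne_zero _ hπ.ne_zero
  have hsub : gcoset (π ^ k) u.1 ⊆ A := by
    intro y hy
    rw [hA]
    intro hy'
    have h3 : π ∣ y.1 - u.1 := (dvd_pow_self π (by omega)).trans hy
    exact hu ((dvd_sub_right hy').1 h3)
  refine ⟨⟨_, gcoset_isOpen hπk u.2 (gcop hπ hu k), Set.inter_eq_left.2 hsub⟩,
    closure (gcoset (π ^ k) u.1), isClosed_closure, ?_⟩
  apply Set.Subset.antisymm
  · rintro w ⟨hw, hwA⟩
    rw [gmem_closure' hπk (gcop hπ hu k)] at hw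
    exact hw _ dvd_rfl (gcop hπ ((hA w).1 hwA) k)
  · exact fun w hw => ⟨subset_closure hw, hsub hw⟩

lemma gRel_iff {π₁ π₂ : K[X]} (h1 : Irreducible π₁) (h2 : Irreducible π₂)
    {A B Q : Set (GolombSpace K[X])} (hA : ∀ y, y ∈ A ↔ ¬ π₁ ∣ y.1)
    (hB : ∀ y, y ∈ B ↔ ¬ π₂ ∣ y.1) {u v : GolombSpace K[X]} (hu : IsUnit u.1) (hv : IsUnit v.1) :
    gRel A B Q u v ↔ ∀ k : ℕ, ∃ y ∈ Q, π₁ ^ k ∣ y.1 - u.1 ∧ π₂ ^ k ∣ y.1 - v.1 := by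
  have nu : ∀ {π u : K[X]}, Irreducible π → IsUnit u → ¬ π ∣ u :=
    fun hπ hu h => hπ.not_isUnit (isUnit_of_dvd_unit h hu)
  constructor
  · intro h k
    obtain ⟨y, hy, a, b⟩ := h _ _ (gRC_coset h1 hA (nu h1 hu) (k := k + 1) (by omega))
      (gmem_self _ _) (gRC_coset h2 hB (nu h2 hv) (k := k + 1) (by omega)) (gmem_self _ _)
    exact ⟨y, hy, (pow_dvd_pow _ (by omega)).trans a, (pow_dvd_pow _ (by omega)).trans b⟩
  · intro h U V hU huU hV hvV
    obtain ⟨k, -, hk⟩ := gRC_nhds h1 hA hU huU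
    obtain ⟨l, -, hl⟩ := gRC_nhds h2 hB hV hvV
    obtain ⟨y, hy, a, b⟩ := h (k + l)
    exact ⟨y, hy, hk y ((pow_dvd_pow _ (by omega)).trans a),
      hl y ((pow_dvd_pow _ (by omega)).trans b)⟩

end basics

/-! ### Units and divisibility are topological -/

def gUP {X : Type*} [TopologicalSpace X] (x : X) : Prop :=
  ∃ z, z ≠ x ∧ ∀ y, y ≠ x → y ≠ z → gTT x z y

lemma gUP_map {X Y : Type*} [TopologicalSpace X] [TopologicalSpace Y] (e : X ≃ₜ Y) {x : X}
    (h : gUP x) : gUP (e x) := by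
  obtain ⟨z, hz, h⟩ := h
  refine ⟨e z, fun h' => hz (e.injective h'), fun y h1 h2 => ?_⟩
  have := gTT_map e (h (e.symm y) (fun h' => h1 (by rw [← h']; simp))
    (fun h' => h2 (by rw [← h']; simp)))
  simpa using this

def gTwo (K : Type*) [Field K] : Prop := ∃ s : Kˣ, s ≠ 1

section units

variable {K : Type*} [Field K]

def gu (a : Kˣ) : GolombSpace K[X] := ⟨C (a : K), by simp⟩

lemma gu_isUnit (a : Kˣ) : IsUnit (gu a).1 := isUnit_C.2 a.isUnit

lemma gu_inj {a b : Kˣ} (h : gu a = gu b) : a = b :=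
  Units.ext (C_injective (congrArg Subtype.val h))

lemma gu_surj {x : GolombSpace K[X]} (h : IsUnit x.1) : ∃ a : Kˣ, gu a = x := by
  obtain ⟨r, hr, hx⟩ := Polynomial.isUnit_iff.1 h
  exact ⟨hr.unit, Subtype.ext hx⟩

lemma gS_of_isUnit {x y : K[X]} (h : IsUnit x) : gS x y :=
  fun _ hπ hd => absurd (isUnit_of_dvd_unit hd h) hπ.not_isUnit

lemma gnS_of_isUnit {x y : K[X]} (hx0 : x ≠ 0) (hx : ¬ IsUnit x) (hy : IsUnit y) : ¬ gS x y := by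
  intro h
  obtain ⟨π, hπ, hd⟩ := WfDvdMonoid.exists_irreducible_factor hx hx0
  exact hπ.not_isUnit (isUnit_of_dvd_unit (h π hπ hd) hy)

lemma gUP_isUnit {x : GolombSpace K[X]} (h : gUP x) : IsUnit x.1 := by
  by_contra hx
  obtain ⟨z, hz, h⟩ := h
  obtain ⟨π, hπ, hd⟩ := WfDvdMonoid.exists_irreducible_factor hx x.2
  have key : ∀ n : ℕ, ¬ π ∣ 1 + π ^ (n + 1) := by
    intro n hn
    have h1 : π ∣ π ^ (n + 1) := dvd_pow_self π (by omega)
    exact hπ.not_isUnit (isUnit_of_dvd_one ((dvd_add_left h1).1 hn))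
  let f : ℕ → GolombSpace K[X] := fun n => ⟨1 + π ^ (n + 1), fun h0 => key n (by rw [h0]; simp)⟩
  have hf : Function.Injective f := by
    intro a b hab
    have h1 : 1 + π ^ (a + 1) = 1 + π ^ (b + 1) := congrArg Subtype.val hab
    have h2 := pow_injective_of_not_isUnit hπ.not_isUnit hπ.ne_zero (add_left_cancel h1)
    omega
  obtain ⟨y, ⟨n, rfl⟩, hy⟩ := (Set.infinite_range_of_injective hf).exists_notMem_finite
    (Set.toFinite ({x, z} : Set (GolombSpace K[X])))
  simp only [Set.mem_insert_iff, Set.mem_singleton_iff, not_or] at hy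
  exact key n (gS_of_TT hy.2 (h _ hy.1 hy.2) π hπ hd)

lemma gUP_of (hK : gTwo K) {x : GolombSpace K[X]} (h : IsUnit x.1) : gUP x := by
  obtain ⟨s, hs⟩ := hK
  obtain ⟨a, rfl⟩ := gu_surj h
  have hne : gu (s * a) ≠ gu a := fun h => hs (by simpa using gu_inj h)
  exact ⟨gu (s * a), hne, fun y _ _ => gTT_of hne.symm (gS_of_isUnit h)
    (gS_of_isUnit (gu_isUnit _))⟩

variable {L : Type*} [Field L]

lemma gUnit_map (e : GolombSpace K[X] ≃ₜ GolombSpace L[X]) (hK : gTwo K) {x : GolombSpace K[X]}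
    (h : IsUnit x.1) : IsUnit (e x).1 := gUP_isUnit (gUP_map e (gUP_of hK h))

lemma gTwo_map (e : GolombSpace K[X] ≃ₜ GolombSpace L[X]) (hK : gTwo K) : gTwo L := by
  have hK' := hK
  obtain ⟨s, hs⟩ := hK
  obtain ⟨a, ha⟩ := gu_surj (gUnit_map e hK' (gu_isUnit s))
  obtain ⟨b, hb⟩ := gu_surj (gUnit_map e hK' (gu_isUnit 1))
  refine ⟨a / b, fun h => hs ?_⟩
  rw [div_eq_one] at h
  rw [h, hb] at ha
  exact gu_inj (e.injective ha.symm)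

lemma gUnit_iff (e : GolombSpace K[X] ≃ₜ GolombSpace L[X]) (hK : gTwo K) (x : GolombSpace K[X]) :
    IsUnit (e x).1 ↔ IsUnit x.1 :=
  ⟨fun h => by simpa using gUnit_map e.symm (gTwo_map e hK) h, gUnit_map e hK⟩

lemma gS_map (e : GolombSpace K[X] ≃ₜ GolombSpace L[X]) (hK : gTwo K) {x y : GolombSpace K[X]}
    (h : gS x.1 y.1) : gS (e x).1 (e y).1 := by
  by_cases hx : IsUnit x.1
  · exact gS_of_isUnit (gUnit_map e hK hx)
  by_cases hy : IsUnit y.1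
  · exact absurd h (gnS_of_isUnit x.2 hx hy)
  have h1 : gu 1 ≠ x := by rintro rfl; exact hx (gu_isUnit _)
  have h2 : y ≠ gu 1 := by rintro rfl; exact hy (gu_isUnit _)
  have := gTT_map e (gTT_of h1 (gS_of_isUnit (gu_isUnit 1)) h)
  exact gS_of_TT (fun h => h2 (e.injective h)) (gTT_symm this)

lemma gS_iff (e : GolombSpace K[X] ≃ₜ GolombSpace L[X]) (hK : gTwo K) (x y : GolombSpace K[X]) :
    gS (e x).1 (e y).1 ↔ gS x.1 y.1 :=
  ⟨fun h => by simpa using gS_map e.symm (gTwo_map e hK) h, gS_map e hK⟩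

def gA (p : GolombSpace K[X]) : Set (GolombSpace K[X]) := {y | ¬ gS p.1 y.1}

def gQ (q : GolombSpace K[X]) : Set (GolombSpace K[X]) := {y | ¬ IsUnit y.1 ∧ gS y.1 q.1}

lemma gA_pre (e : GolombSpace K[X] ≃ₜ GolombSpace L[X]) (hK : gTwo K) (p : GolombSpace K[X]) :
    e ⁻¹' gA (e p) = gA p := by
  ext y
  exact not_congr (gS_iff e hK p y)

lemma gQ_pre (e : GolombSpace K[X] ≃ₜ GolombSpace L[X]) (hK : gTwo K) (q : GolombSpace K[X]) :
    e ⁻¹' gQ (e q) = gQ q := by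
  ext y
  exact and_congr (not_congr (gUnit_iff e hK y)) (gS_iff e hK y q)

def gJ (p : GolombSpace K[X]) : Prop :=
  ¬ IsUnit p.1 ∧ ∀ z : GolombSpace K[X], ¬ IsUnit z.1 → gS z.1 p.1 → gS p.1 z.1

lemma gS_irr {π : K[X]} (h : Irreducible π) (y : K[X]) : gS π y ↔ π ∣ y := by
  constructor
  · exact fun hS => hS π h dvd_rfl
  · exact fun hd ρ _ hρ' => hρ'.trans hd

lemma gJ_of {p : GolombSpace K[X]} (h : Irreducible p.1) : gJ p := by
  refine ⟨h.not_isUnit, fun z hz hS => ?_⟩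
  obtain ⟨π, hπ, hd⟩ := WfDvdMonoid.exists_irreducible_factor hz z.2
  rw [gS_irr h]
  exact ((hπ.associated_of_dvd h (hS π hπ hd)).symm.dvd).trans hd

lemma gJ_irr {p : GolombSpace K[X]} (h : gJ p) :
    ∃ π, Irreducible π ∧ ∀ y, gS p.1 y ↔ π ∣ y := by
  obtain ⟨π, hπ, hd⟩ := WfDvdMonoid.exists_irreducible_factor h.1 p.2
  refine ⟨π, hπ, fun y => ⟨fun hS => hS π hπ hd, fun hy => ?_⟩⟩
  have := h.2 ⟨π, hπ.ne_zero⟩ hπ.not_isUnit ((gS_irr hπ _).2 hd)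
  exact fun ρ hρ hρd => (this ρ hρ hρd).trans hy

lemma gJ_map (e : GolombSpace K[X] ≃ₜ GolombSpace L[X]) (hK : gTwo K) {p : GolombSpace K[X]}
    (h : gJ p) : gJ (e p) := by
  refine ⟨fun h' => h.1 ((gUnit_iff e hK p).1 h'), fun z hz hS => ?_⟩
  obtain ⟨z, rfl⟩ := e.surjective z
  rw [gS_iff e hK] at hS ⊢
  rw [gUnit_iff e hK] at hz
  exact h.2 z hz hS

/-- the set of units `a` such that `Q` accumulates at `(1, a)` in the `(π₁, π₂)`-topology -/
def gM (π₁ π₂ : K[X]) (Q : Set (GolombSpace K[X])) : Set Kˣ :=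
  {a | ∀ k : ℕ, ∃ y ∈ Q, π₁ ^ k ∣ y.1 - 1 ∧ π₂ ^ k ∣ y.1 - C (a : K)}

lemma gQ_smul {q y : GolombSpace K[X]} (hy : y ∈ gQ q) {a : K[X]} (ha : IsUnit a) :
    (⟨a * y.1, mul_ne_zero ha.ne_zero y.2⟩ : GolombSpace K[X]) ∈ gQ q := by
  refine ⟨fun h => hy.1 (isUnit_of_mul_isUnit_right h), fun π hπ hd => hy.2 π hπ ?_⟩
  exact (ha.dvd_mul_left).1 hd

lemma gRel_iff_M {p₁ p₂ q : GolombSpace K[X]} {π₁ π₂ : K[X]} (h1 : Irreducible π₁)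
    (h2 : Irreducible π₂) (hA : ∀ y, gS p₁.1 y ↔ π₁ ∣ y) (hB : ∀ y, gS p₂.1 y ↔ π₂ ∣ y)
    (a b : Kˣ) : gRel (gA p₁) (gA p₂) (gQ q) (gu a) (gu b) ↔ b / a ∈ gM π₁ π₂ (gQ q) := by
  rw [gRel_iff h1 h2 (A := gA p₁) (B := gA p₂) (fun y => not_congr (hA y.1))
    (fun y => not_congr (hB y.1)) (gu_isUnit a) (gu_isUnit b)]
  have e1 : (C (a : K) : K[X]) * C ((a⁻¹ : Kˣ) : K) = 1 := by rw [← C_mul]; simp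
  have e2 : (C ((b / a : Kˣ) : K) : K[X]) = C (b : K) * C ((a⁻¹ : Kˣ) : K) := by
    rw [← C_mul, ← Units.val_mul, div_eq_mul_inv]
  constructor
  · intro h k
    obtain ⟨y, hy, d1, d2⟩ := h k
    refine ⟨_, gQ_smul hy (gu_isUnit a⁻¹), ?_, ?_⟩
    · have : (gu a⁻¹).1 * y.1 - 1 = (gu a⁻¹).1 * (y.1 - (gu a).1) := by
        simp only [gu]; linear_combination e1
      rw [this]; exact d1.mul_left _
    · have : (gu a⁻¹).1 * y.1 - C ((b / a : Kˣ) : K) = (gu a⁻¹).1 * (y.1 - (gu b).1) := by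
        rw [e2]; simp only [gu]; ring
      show _ ∣ (gu a⁻¹).1 * y.1 - C ((b / a : Kˣ) : K)
      rw [this]; exact d2.mul_left _
  · intro h k
    obtain ⟨y, hy, d1, d2⟩ := h k
    refine ⟨_, gQ_smul hy (gu_isUnit a), ?_, ?_⟩
    · have : (gu a).1 * y.1 - (gu a).1 = (gu a).1 * (y.1 - 1) := by ring
      rw [this]; exact d1.mul_left _
    · have : (gu a).1 * y.1 - (gu b).1 = (gu a).1 * (y.1 - C ((b / a : Kˣ) : K)) := by
        rw [e2]; simp only [gu]; linear_combination (C (b : K)) * e1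
      show _ ∣ (gu a).1 * y.1 - (gu b).1
      rw [this]; exact d2.mul_left _

lemma gM_mul {π₁ π₂ : K[X]} {q : GolombSpace K[X]} {a b : Kˣ} (ha : a ∈ gM π₁ π₂ (gQ q))
    (hb : b ∈ gM π₁ π₂ (gQ q)) : a * b ∈ gM π₁ π₂ (gQ q) := by
  intro k
  obtain ⟨y, hy, d1, d2⟩ := ha k
  obtain ⟨z, hz, d3, d4⟩ := hb k
  refine ⟨⟨y.1 * z.1, mul_ne_zero y.2 z.2⟩, ⟨fun h => hy.1 (isUnit_of_mul_isUnit_left h),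
    fun π hπ hd => (hπ.prime.dvd_or_dvd hd).elim (hy.2 π hπ) (hz.2 π hπ)⟩, ?_, ?_⟩
  · have : y.1 * z.1 - 1 = y.1 * (z.1 - 1) + (y.1 - 1) := by ring
    rw [this]; exact dvd_add (d3.mul_left _) d1
  · have : y.1 * z.1 - C ((a * b : Kˣ) : K) = y.1 * (z.1 - C (b : K)) + (y.1 - C (a : K)) * C (b : K) := by
      rw [Units.val_mul, C_mul]; ring
    show _ ∣ y.1 * z.1 - C ((a * b : Kˣ) : K)
    rw [this]; exact dvd_add (d4.mul_left _) (d2.mul_right _)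

lemma gTransfer (e : GolombSpace K[X] ≃ₜ GolombSpace L[X]) (hK : gTwo K)
    {p₁ p₂ : GolombSpace K[X]} (q : GolombSpace K[X]) (h1 : Irreducible p₁.1)
    (h2 : Irreducible p₂.1) :
    ∃ π₁ π₂ : L[X], Irreducible π₁ ∧ Irreducible π₂ ∧ (∀ y, gS (e p₁).1 y ↔ π₁ ∣ y) ∧
      (∀ y, gS (e p₂).1 y ↔ π₂ ∣ y) ∧ ∃ f : Kˣ → Lˣ, Function.Bijective f ∧ f 1 = 1 ∧
      ∀ b, b ∈ gM p₁.1 p₂.1 (gQ q) ↔ f b ∈ gM π₁ π₂ (gQ (e q)) := by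
  obtain ⟨π₁, hπ₁, hS1⟩ := gJ_irr (gJ_map e hK (gJ_of h1))
  obtain ⟨π₂, hπ₂, hS2⟩ := gJ_irr (gJ_map e hK (gJ_of h2))
  refine ⟨π₁, π₂, hπ₁, hπ₂, hS1, hS2, ?_⟩
  choose σ hσ using fun a : Kˣ => gu_surj (gUnit_map e hK (gu_isUnit a))
  refine ⟨fun b => σ b / σ 1, ⟨fun a b hab => ?_, fun c => ?_⟩, by simp, fun b => ?_⟩
  · have h3 : σ a = σ b := div_left_injective hab
    have h4 : e (gu a) = e (gu b) := by rw [← hσ, ← hσ, h3]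
    exact gu_inj (e.injective h4)
  · obtain ⟨x, hx⟩ := e.surjective (gu (c * σ 1))
    have hu : IsUnit x.1 := by rw [← gUnit_iff e hK, hx]; exact gu_isUnit _
    obtain ⟨a, rfl⟩ := gu_surj hu
    refine ⟨a, ?_⟩
    rw [← hσ] at hx
    simp [gu_inj hx]
  · have h3 := gRel_iff_M (q := q) h1 h2 (gS_irr h1) (gS_irr h2) 1 b
    rw [div_one] at h3
    rw [← h3, ← gRel_iff_M hπ₁ hπ₂ hS1 hS2, hσ, hσ]
    constructor
    · intro h
      apply gRel_map e
      rwa [gA_pre e hK, gA_pre e hK, gQ_pre e hK]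
    · intro h
      have h5 := gRel_map e.symm (A := gA p₁) (B := gA p₂) (Q := gQ q) (u := e (gu 1))
        (v := e (gu b))
      simp only [Homeomorph.symm_apply_apply] at h5
      apply h5
      rw [← gA_pre e hK, ← gA_pre e hK p₂, ← gQ_pre e hK]
      simpa [← Set.preimage_comp] using h

/-! ### linear primes -/

def gX : GolombSpace K[X] := ⟨X, X_ne_zero⟩
def gXs (s : Kˣ) : GolombSpace K[X] := ⟨X - C (s : K), X_sub_C_ne_zero _⟩

lemma gQ_X {y : GolombSpace K[X]} (hy : y ∈ gQ (gX : GolombSpace K[X])) :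
    ∃ (w : Kˣ) (n : ℕ), 1 ≤ n ∧ y.1 = X ^ n * C (w : K) := by
  obtain ⟨n, d, hd, hX⟩ := gsplit (irreducible_X (R := K)) y.2
  have hd0 : d ≠ 0 := by rintro rfl; simp at hX
  have hu : IsUnit d := by
    by_contra hu
    obtain ⟨ρ, hρ, hρd⟩ := WfDvdMonoid.exists_irreducible_factor hu hd0
    have := hy.2 ρ hρ (by rw [hd]; exact hρd.mul_left _)
    exact hX (((hρ.associated_of_dvd irreducible_X this).symm.dvd).trans hρd)
  obtain ⟨w, hw⟩ := gu_surj (x := ⟨d, hd0⟩) hu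
  have hw' : C (w : K) = d := congrArg Subtype.val hw
  refine ⟨w, n, ?_, by rw [hd, hw']⟩
  by_contra hn
  obtain rfl : n = 0 := by omega
  exact hy.1 (by rw [hd]; simpa using hu)

lemma gM_lin {s v : Kˣ} (h : v ∈ gM (gXs (1 : Kˣ)).1 (gXs s).1 (gQ gX)) :
    ∃ n : ℕ, 1 ≤ n ∧ v = s ^ n := by
  obtain ⟨y, hy, d1, d2⟩ := h 1
  obtain ⟨w, n, hn, hw⟩ := gQ_X hy
  rw [pow_one, hw] at d1 d2
  have e1 := (dvd_iff_isRoot.1 d1)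
  have e2 := (dvd_iff_isRoot.1 d2)
  simp [IsRoot] at e1 e2
  refine ⟨n, hn, Units.ext ?_⟩
  have : (w : K) = 1 := by linear_combination e1
  rw [this] at e2
  push_cast
  linear_combination -e2

lemma gM_lin' (p : ℕ) [Fact p.Prime] [CharP K p] {s : Kˣ} (hs : IsOfFinOrder s) (j : ℕ) :
    s ^ j ∈ gM (gXs (1 : Kˣ)).1 (gXs s).1 (gQ gX) := by
  have hp : p.Prime := Fact.out
  have hm := hs.orderOf_pos
  obtain ⟨r, hr, hsr⟩ : ∃ r, 1 ≤ r ∧ s ^ (p ^ r) = s := by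
    have hco : Nat.Coprime p (orderOf s) := by
      rw [hp.coprime_iff_not_dvd]
      rintro ⟨t, ht⟩
      have h1 : (s ^ t) ^ p = 1 := by rw [← pow_mul, mul_comm, ← ht, pow_orderOf_eq_one]
      have h2 : s ^ t = 1 := by
        apply Units.ext
        apply frobenius_inj K p
        have := congrArg Units.val h1
        simpa [frobenius_def] using this
      have h3 := orderOf_dvd_of_pow_eq_one h2
      have ht0 : 0 < t := by
        rcases Nat.eq_zero_or_pos t with rfl | h
        · rw [mul_zero] at ht; omega
        · exact h
      have := Nat.le_of_dvd ht0 h3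
      have := hp.two_le
      nlinarith
    refine ⟨Nat.totient (orderOf s), Nat.totient_pos.2 hm, ?_⟩
    have := Nat.ModEq.pow_totient hco
    conv_rhs => rw [← pow_one s]
    rwa [pow_eq_pow_iff_modEq]
  have hsr' : ∀ k, s ^ (p ^ (r * k)) = s := by
    intro k
    induction k with
    | zero => simp
    | succ k ih => rw [Nat.mul_succ, pow_add, pow_mul, ih, hsr]
  intro k
  let i := j + orderOf s
  have hi : s ^ i = s ^ j := by simp [i, pow_add, pow_orderOf_eq_one]
  let N := p ^ (r * k)
  have hNk : k ≤ N := by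
    have h1 : k ≤ r * k := Nat.le_mul_of_pos_left k hr
    have h2 : r * k < p ^ (r * k) := Nat.lt_pow_self hp.one_lt
    omega
  have key : ∀ t : K, (X - C t) ^ k ∣ (X : K[X]) ^ (i * N) - C (t ^ (i * N)) := by
    intro t
    have h1 : (X : K[X]) ^ (i * N) - C (t ^ (i * N)) = (X ^ i - C t ^ i) ^ N := by
      rw [sub_pow_char_pow, ← pow_mul, ← pow_mul, C_pow]
    rw [h1]
    exact (pow_dvd_pow _ hNk).trans (pow_dvd_pow_of_dvd (sub_dvd_pow_sub_pow _ _ _) _)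
  have hn : i * N ≠ 0 := mul_ne_zero (by omega) (pow_ne_zero _ hp.ne_zero)
  refine ⟨⟨X ^ (i * N), pow_ne_zero _ X_ne_zero⟩, ⟨?_, ?_⟩, ?_, ?_⟩
  · intro h
    exact irreducible_X.not_isUnit ((isUnit_pow_iff hn).1 h)
  · intro π hπ hd
    exact hπ.prime.dvd_of_dvd_pow hd
  · have := key 1
    simpa [gXs] using this
  · have h2 := key (s : K)
    have h3 : (s : K) ^ (i * N) = ((s ^ j : Kˣ) : K) := by
      rw [← hi, ← Units.val_pow_eq_pow_val, mul_comm, pow_mul, hsr']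
    rw [h3] at h2
    exact h2

lemma gM_lin_eq (p : ℕ) [Fact p.Prime] [CharP K p] {s : Kˣ} (hs : IsOfFinOrder s) :
    gM (gXs (1 : Kˣ)).1 (gXs s).1 (gQ gX) = (Subgroup.zpowers s : Set Kˣ) := by
  ext v
  constructor
  · intro h
    obtain ⟨n, -, rfl⟩ := gM_lin h
    exact ⟨n, by simp⟩
  · intro h
    obtain ⟨j, rfl⟩ := hs.mem_powers_iff_mem_zpowers.2 h
    exact gM_lin' p hs j

lemma gXs_irr (s : Kˣ) : Irreducible (gXs s).1 := irreducible_X_sub_C _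

/-- a finite nonempty multiplicatively closed set of units has an element of that order -/
lemma gcyc {M : Set Kˣ} (hf : M.Finite) (h1 : (1 : Kˣ) ∈ M)
    (hm : ∀ a ∈ M, ∀ b ∈ M, a * b ∈ M) : ∃ t : Kˣ, orderOf t = M.ncard := by
  have hpow : ∀ a ∈ M, ∀ n : ℕ, a ^ n ∈ M := by
    intro a ha n
    induction n with
    | zero => simpa using h1
    | succ n ih => rw [pow_succ]; exact hm _ ih _ ha
  let H : Subgroup Kˣ :=
    { carrier := M
      mul_mem' := fun {a b} ha hb => hm a ha b hb
      one_mem' := h1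
      inv_mem' := by
        intro a ha
        have hfin : IsOfFinOrder a := by
          by_contra hn
          exact (Set.infinite_of_injective_forall_mem
            (injective_pow_iff_not_isOfFinOrder.2 hn) (hpow a ha)) hf
        have : a⁻¹ = a ^ (orderOf a - 1) := by
          rw [inv_eq_iff_mul_eq_one, ← pow_succ', Nat.sub_add_cancel hfin.orderOf_pos,
            pow_orderOf_eq_one]
        rw [this]
        exact hpow a ha _ }
  have : Finite H := hf
  obtain ⟨g, hg⟩ := IsCyclic.exists_ofOrder_eq_natCard (α := H)
  exact ⟨(g : Kˣ), by rw [Subgroup.orderOf_coe, hg]; rfl⟩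

lemma gorders (p : ℕ) [Fact p.Prime] [CharP K p] (e : GolombSpace K[X] ≃ₜ GolombSpace L[X])
    {s : Kˣ} (hs : IsOfFinOrder s) : ∃ t : Lˣ, orderOf t = orderOf s := by
  by_cases hs1 : s = 1
  · exact ⟨1, by simp [hs1]⟩
  obtain ⟨π₁, π₂, -, -, -, -, f, hf, hf1, hM⟩ :=
    gTransfer e ⟨s, hs1⟩ gX (gXs_irr 1) (gXs_irr s)
  set M := gM π₁ π₂ (gQ (e gX)) with hMdef
  have hpre : f '' (Subgroup.zpowers s : Set Kˣ) = M := by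
    rw [← gM_lin_eq p hs]
    ext v
    constructor
    · rintro ⟨b, hb, rfl⟩; exact (hM b).1 hb
    · intro hv
      obtain ⟨b, rfl⟩ := hf.2 v
      exact ⟨b, (hM b).2 hv, rfl⟩
  have hcard : M.ncard = orderOf s := by
    rw [← hpre, Set.ncard_image_of_injective _ hf.1, ← Nat.card_zpowers]; rfl
  have hfin : M.Finite := by
    rw [← hpre]
    apply Set.Finite.image
    exact Set.finite_of_ncard_ne_zero (by
      have : (Subgroup.zpowers s : Set Kˣ).ncard = orderOf s := by rw [← Nat.card_zpowers]; rfl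
      rw [this]; exact hs.orderOf_pos.ne')
  rw [← hcard]
  refine gcyc hfin ?_ (fun a ha b hb => gM_mul ha hb)
  rw [← hpre]
  exact ⟨1, Subgroup.one_mem _, hf1⟩

/-! ### Torsion -/

lemma gtorsion (p : ℕ) [Fact p.Prime] [Algebra (ZMod p) K]
    (halg : Algebra.IsAlgebraic (ZMod p) K) {c q : K[X]} (hc : c ≠ 0) (h : IsCoprime c q) :
    ∃ n : ℕ, 1 ≤ n ∧ c ∣ q ^ n - 1 := by
  have : Module.Finite K (AdjoinRoot c) := (AdjoinRoot.powerBasis hc).finite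
  have : Algebra.IsIntegral (ZMod p) K := Algebra.isAlgebraic_iff_isIntegral.1 halg
  have : Algebra.IsIntegral (ZMod p) (AdjoinRoot c) := Algebra.IsIntegral.trans K
  set a := AdjoinRoot.mk c q with ha
  have hint : IsIntegral (ZMod p) a := Algebra.IsIntegral.isIntegral a
  have : Module.Finite (ZMod p) (Algebra.adjoin (ZMod p) {a}) :=
    Module.Finite.iff_fg.2 hint.fg_adjoin_singleton
  have : Finite (Algebra.adjoin (ZMod p) {a}) := Module.finite_of_finite (ZMod p)
  let g : ℕ → Algebra.adjoin (ZMod p) {a} :=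
    fun n => ⟨a ^ n, pow_mem (Algebra.self_mem_adjoin_singleton _ _) n⟩
  obtain ⟨i, j, hij, hg⟩ := Finite.exists_ne_map_eq_of_infinite g
  have hg' : a ^ i = a ^ j := congrArg Subtype.val hg
  clear hg
  wlog hlt : i < j generalizing i j
  · exact this j i hij.symm hg'.symm (by omega)
  refine ⟨j - i, by omega, ?_⟩
  have hd : c ∣ q ^ j - q ^ i := by
    rw [← AdjoinRoot.mk_eq_mk, map_pow, map_pow, ← ha, hg']
  have : q ^ j - q ^ i = q ^ i * (q ^ (j - i) - 1) := by
    rw [mul_sub, ← pow_add, mul_one, Nat.add_sub_cancel' hlt.le]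
  rw [this] at hd
  exact (h.pow_right (n := i)).dvd_of_dvd_mul_left hd

lemma gM_one (p : ℕ) [Fact p.Prime] [Algebra (ZMod p) K]
    (halg : Algebra.IsAlgebraic (ZMod p) K) {π₁ π₂ : K[X]} (h1 : Irreducible π₁)
    (h2 : Irreducible π₂) {q : GolombSpace K[X]} (hq : ¬ IsUnit q.1) (d1 : ¬ π₁ ∣ q.1)
    (d2 : ¬ π₂ ∣ q.1) : (1 : Kˣ) ∈ gM π₁ π₂ (gQ q) := by
  intro k
  obtain ⟨n, hn, hd⟩ := gtorsion p halg (c := π₁ ^ k * π₂ ^ k) (q := q.1)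
    (mul_ne_zero (pow_ne_zero _ h1.ne_zero) (pow_ne_zero _ h2.ne_zero))
    ((gcop h1 d1 k).mul_left (gcop h2 d2 k))
  refine ⟨⟨q.1 ^ n, pow_ne_zero _ q.2⟩, ⟨fun h => hq ((isUnit_pow_iff (by omega)).1 h),
    fun π hπ hd => hπ.prime.dvd_of_dvd_pow hd⟩, (dvd_mul_right _ _).trans hd, ?_⟩
  simpa using (dvd_mul_left _ _).trans hd

lemma gXs_not_dvd (s : Kˣ) : ¬ (gXs s).1 ∣ (X : K[X]) := by
  intro h
  have := dvd_iff_isRoot.1 h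
  simp [IsRoot] at this

lemma gfinOrder (p : ℕ) [Fact p.Prime] [Algebra (ZMod p) K]
    (halg : Algebra.IsAlgebraic (ZMod p) K) (e : GolombSpace L[X] ≃ₜ GolombSpace K[X])
    (s : Lˣ) : IsOfFinOrder s := by
  by_cases hs1 : s = 1
  · simp [hs1]
  have hL : gTwo L := ⟨s, hs1⟩
  obtain ⟨π₁, π₂, i1, i2, hS1, hS2, f, hf, hf1, hM⟩ :=
    gTransfer e hL gX (gXs_irr 1) (gXs_irr s)
  have nd : ∀ t : Lˣ, ¬ gS (e (gXs t)).1 (e gX).1 := by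
    intro t
    rw [gS_iff e hL, gS_irr (gXs_irr t)]
    exact gXs_not_dvd t
  have h1 : (1 : Kˣ) ∈ gM π₁ π₂ (gQ (e gX)) := by
    apply gM_one p halg i1 i2
    · rw [gUnit_iff e hL]; exact irreducible_X.not_isUnit
    · rw [← hS1]; exact nd 1
    · rw [← hS2]; exact nd s
  rw [← hf1, ← hM] at h1
  obtain ⟨n, hn, h⟩ := gM_lin h1
  exact isOfFinOrder_iff_pow_eq_one.2 ⟨n, hn, h.symm⟩

end units

/-! ### Conclusion -/

lemma galg_fin {F K : Type*} [Field F] [Finite F] [Field K] [Algebra F K]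
    [Algebra.IsAlgebraic F K] (s : Kˣ) : IsOfFinOrder s := by
  have : Algebra.IsIntegral F K := Algebra.isAlgebraic_iff_isIntegral.1 inferInstance
  have hint : IsIntegral F (s : K) := Algebra.IsIntegral.isIntegral _
  have : Module.Finite F (Algebra.adjoin F {(s : K)}) :=
    Module.Finite.iff_fg.2 hint.fg_adjoin_singleton
  have : Finite (Algebra.adjoin F {(s : K)}) := Module.finite_of_finite F
  by_contra hn
  rw [← injective_pow_iff_not_isOfFinOrder] at hn
  let g : ℕ → Algebra.adjoin F {(s : K)} :=
    fun n => ⟨(s : K) ^ n, pow_mem (Algebra.self_mem_adjoin_singleton _ _) n⟩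
  refine not_injective_infinite_finite g (fun i j hij => hn ?_)
  have : (s : K) ^ i = (s : K) ^ j := congrArg Subtype.val hij
  exact Units.ext (by simpa using this)

lemma grange {K L Ω : Type*} [Field K] [Field L] [Field Ω] (f : K →+* Ω) (g : L →+* Ω)
    (ht : ∀ s : Kˣ, IsOfFinOrder s) (h : ∀ s : Kˣ, ∃ t : Lˣ, orderOf t = orderOf s) (x : K) :
    ∃ y : L, g y = f x := by
  by_cases hx : x = 0
  · exact ⟨0, by simp [hx]⟩
  let s : Kˣ := Units.mk0 x hx
  obtain ⟨t, hts⟩ := h s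
  have h1 : orderOf (g (t : L)) = orderOf s := by
    rw [← hts, ← orderOf_units]
    exact orderOf_injective (g : L →* Ω) g.injective (t : L)
  have h2 : f x ^ orderOf s = 1 := by
    have h3 : s ^ orderOf s = 1 := pow_orderOf_eq_one s
    have h4 : x ^ orderOf s = 1 := by
      have h5 := congrArg Units.val h3
      rwa [Units.val_pow_eq_pow_val] at h5
    rw [← map_pow, h4, map_one]
  have hp : IsPrimitiveRoot (g (t : L)) (orderOf s) := h1 ▸ IsPrimitiveRoot.orderOf _
  have : NeZero (orderOf s) := ⟨(ht s).orderOf_pos.ne'⟩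
  obtain ⟨i, -, hi⟩ := hp.eq_pow_of_pow_eq_one h2
  exact ⟨(t : L) ^ i, by rw [map_pow, hi]⟩

/-- Let `p` be a prime, `K` a field of characteristic `p` that is algebraic over
its prime field `𝔽_p`, and `K'` any field of characteristic `p`. If the Golomb spaces
`G(K[X])` and `G(K'[X])` are homeomorphic, then `K` and `K'` are isomorphic as fields. -/
theorem field_iso_of_golomb_homeomorph (p : ℕ) [Fact p.Prime]
    (K : Type*) [Field K] [CharP K p] [Algebra (ZMod p) K]
    (halg : Algebra.IsAlgebraic (ZMod p) K)
    (K' : Type*) [Field K'] [CharP K' p]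
    (h : Nonempty (GolombSpace (Polynomial K) ≃ₜ GolombSpace (Polynomial K'))) :
    Nonempty (K ≃+* K') := by
  obtain ⟨e⟩ := h
  have t1 : ∀ s : Kˣ, IsOfFinOrder s := galg_fin (F := ZMod p)
  have t2 : ∀ s : K'ˣ, IsOfFinOrder s := gfinOrder p halg e.symm
  have o1 : ∀ s : Kˣ, ∃ t : K'ˣ, orderOf t = orderOf s := fun s => gorders p e (t1 s)
  have o2 : ∀ s : K'ˣ, ∃ t : Kˣ, orderOf t = orderOf s := fun s => gorders p e.symm (t2 s)
  let _ : Algebra (ZMod p) K' := ZMod.algebra K' p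
  have halg' : Algebra.IsAlgebraic (ZMod p) K' := by
    refine ⟨fun x => ?_⟩
    by_cases hx : x = 0
    · rw [hx]; exact isAlgebraic_zero
    · obtain ⟨n, hn, hpow⟩ := isOfFinOrder_iff_pow_eq_one.1 (t2 (Units.mk0 x hx))
      have h4 : x ^ n = 1 := by simpa using congrArg Units.val hpow
      refine IsIntegral.isAlgebraic (IsIntegral.of_pow hn ?_)
      rw [h4]; exact isIntegral_one
  let Ω := AlgebraicClosure (ZMod p)
  let f : K →+* Ω := (IsAlgClosed.lift (R := ZMod p) (S := K) (M := Ω)).toRingHom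
  let g : K' →+* Ω := (IsAlgClosed.lift (R := ZMod p) (S := K') (M := Ω)).toRingHom
  have hr : f.range = g.range := by
    ext z
    constructor
    · rintro ⟨x, rfl⟩; exact grange f g t1 o1 x
    · rintro ⟨x, rfl⟩; exact grange g f t2 o2 x
  exact ⟨(RingEquiv.ofBijective f.rangeRestrict ⟨fun a b hab => f.injective
      (congrArg Subtype.val hab), f.rangeRestrict_surjective⟩).trans
    ((RingEquiv.subringCongr hr).trans (RingEquiv.ofBijective g.rangeRestrict
      ⟨fun a b hab => g.injective (congrArg Subtype.val hab), g.rangeRestrict_surjective⟩).symm)⟩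

end
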